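/- For every T > 0 there exist positive constants c₁ and c₂ such that for all t ∈ (0,T] and all x, y ∈ D, the time derivative ∂_t G(x,y,t) exists and satisfies |∂_t G(x,y,t)| ≤ c₁ t^{−(d+4)/4} exp(−c₂ |x−y|^{4/3} t^{−1/3}). -/

import Mathlib

open MeasureTheory Real Set

noncomputable section

/-- The spatial domain `D = (0,π)^d` as a subset of Euclidean space. -/
def domD (d : ℕ) : Set (EuclideanSpace ℝ (Fin d)) :=
  {x | ∀ i, x i ∈ Set.Ioo (0 : ℝ) π}

/-- One-dimensional normalized cosine functions: `ε_0 = 1/√π`, `ε_j(x) = √(2/π) cos(jx)`. -/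
def eps1 (j : ℕ) (x : ℝ) : ℝ :=
  if j = 0 then 1 / Real.sqrt π else Real.sqrt (2 / π) * Real.cos (j * x)

/-- The product functions `ε_k(x) = ∏ i, ε_{k i}(x i)` for a multi-index `k ∈ ℕ^d`. -/
def epsk {d : ℕ} (k : Fin d → ℕ) (x : EuclideanSpace ℝ (Fin d)) : ℝ :=
  ∏ i, eps1 (k i) (x i)

/-- The eigenvalue `λ_k = ∑ i, k_i²`. -/
def lam {d : ℕ} (k : Fin d → ℕ) : ℝ := ∑ i, (k i : ℝ) ^ 2

/-- The Green's function of `−Δ²+Δ` with homogeneous Neumann boundary conditions on `D`: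
`G(x,y,t) = ∑_{k∈ℕ^d} e^{−(λ_k²+λ_k)t} ε_k(x) ε_k(y)`. -/
def green {d : ℕ} (x y : EuclideanSpace ℝ (Fin d)) (t : ℝ) : ℝ :=
  ∑' k : Fin d → ℕ, Real.exp (-(lam k ^ 2 + lam k) * t) * epsk k x * epsk k y



lemma lemA_aux (c : ℂ) (q : ℝ) (hq : 0 ≤ q) (hqc : q ≤ ‖c - 1‖) (B : ℝ) (hB : 0 ≤ B) (m : ℕ) :
    ∀ F : ℂ → ℂ, Differentiable ℂ F → (∀ a, F (a + 1) = c * F a) →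
      (∀ s : ℝ, ‖iteratedDeriv m F (s : ℂ)‖ ≤ B) → ∀ s : ℝ, q ^ m * ‖F s‖ ≤ B := by
  induction m with
  | zero => intro F hF hc h s; simpa using h s
  | succ m ih =>
    intro F hF hc h s
    have hd : Differentiable ℂ (deriv F) := hF.deriv
    have h1 := ih (deriv F) hd (by
      intro a
      have e1 : deriv (fun x => F (x + 1)) a = deriv F (a + 1) := deriv_comp_add_const F 1 a
      rw [← e1]
      have : (fun x => F (x + 1)) = fun x => c * F x := funext hc
      rw [this, deriv_const_mul_field]) (by
      intro s; rw [← iteratedDeriv_succ']; exact h s)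
    rcases hq.eq_or_lt with h0 | h0
    · rw [← h0]; simpa using hB
    have hqm : 0 < q ^ m := by positivity
    have h2 : ∀ x ∈ {w : ℂ | w.im = 0}, ‖deriv F x‖ ≤ B / q ^ m := by
      intro x hx
      have hx' : x = (x.re : ℂ) := by apply Complex.ext <;> simp; exact hx
      rw [le_div_iff₀ hqm, mul_comm, hx']
      exact h1 x.re
    have hconv : Convex ℝ {w : ℂ | w.im = 0} := by
      intro x hx y hy a b _ _ _
      simp only [mem_ofPred_eq] at *
      simp [hx, hy]
    have h3 := Convex.norm_image_sub_le_of_norm_deriv_le (f := F) (x := (s:ℂ)) (y := (s:ℂ)+1)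
      (fun x _ => hF x) h2 hconv (by simp) (by simp)
    rw [hc] at h3
    have h4 : c * F s - F s = (c - 1) * F s := by ring
    rw [h4, norm_mul] at h3
    simp only [add_sub_cancel_left, norm_one, mul_one] at h3
    rw [le_div_iff₀ hqm] at h3
    calc q ^ (m+1) * ‖F s‖ = q * ‖F s‖ * q ^ m := by ring
      _ ≤ ‖c - 1‖ * ‖F s‖ * q ^ m := by gcongr
      _ ≤ B := h3

lemma lemA (F : ℂ → ℂ) (hF : Differentiable ℂ F) (c : ℂ) (q : ℝ) (hq : 0 ≤ q)
    (hqc : q ≤ ‖c - 1‖) (hc : ∀ a, F (a + 1) = c * F a) (r M : ℝ) (hr : 0 < r)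
    (hM : ∀ a : ℂ, |a.im| ≤ r → ‖F a‖ ≤ M) (m : ℕ) :
    q ^ m * ‖F 0‖ ≤ m.factorial * M / r ^ m := by
  have hM0 : 0 ≤ M := (norm_nonneg _).trans (hM 0 (by simp [hr.le]))
  have := lemA_aux c q hq hqc (m.factorial * M / r ^ m) (by positivity) m F hF hc (by
    intro s
    apply Complex.norm_iteratedDeriv_le_of_forall_mem_sphere_norm_le m hr hF.diffContOnCl
    intro z hz
    apply hM
    have : |(z - s).im| ≤ ‖z - s‖ := Complex.abs_im_le_norm _
    rw [mem_sphere_iff_norm] at hz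
    simpa [hz] using this) 0
  simpa using this

def hh (μ t : ℝ) (w : ℂ) : ℂ :=
  ((w ^ 2 + μ) ^ 2 + (w ^ 2 + μ)) * Complex.exp (-((w ^ 2 + μ) ^ 2 + (w ^ 2 + μ)) * t)

lemma quart (u : ℝ) : u - 1 ≤ u ^ 4 / 4 := by nlinarith [sq_nonneg (u^2-1), sq_nonneg (u-1)]

lemma hh_bound (T μ b : ℝ) (hμ : 0 ≤ μ) (hb : 0 < b) (hbT : b ^ 4 ≤ T) (w : ℂ) :
    ‖hh μ (b ^ 4) w‖ ≤ ((64 + T) * Real.exp (T + 1)) / b ^ 4 * Real.exp (-(b ^ 4) * μ ^ 2 / 4) *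
      Real.exp (20 * b ^ 4 * w.im ^ 4) * Real.exp (-b * |w.re|) := by
  set t := b ^ 4 with ht
  have ht0 : 0 < t := by positivity
  have hT : 0 < T := ht0.trans_le hbT
  set A := w.re ^ 2 + μ with hA
  set B := w.im ^ 2 with hB
  have hB0 : 0 ≤ B := sq_nonneg _
  have hA0 : 0 ≤ A := by positivity
  set P : ℂ := w ^ 2 + μ with hP
  have hPn : ‖P‖ ≤ A + B := by
    calc ‖P‖ ≤ ‖w ^ 2‖ + ‖(μ : ℂ)‖ := norm_add_le _ _
      _ = A + B := by
        rw [norm_pow, Complex.sq_norm, Complex.normSq_apply]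
        simp [abs_of_nonneg hμ]; ring
  have hRe : A ^ 2 / 2 - 17 * B ^ 2 - B ≤ (P ^ 2 + P).re := by
    have : (P ^ 2 + P).re = (A - B) ^ 2 - 4 * w.re ^ 2 * B + (A - B) := by
      simp [hP, pow_two, hA, hB]; ring
    rw [this]
    have h1 : w.re ^ 2 * B ≤ A * B := by
      apply mul_le_mul_of_nonneg_right _ hB0; rw [hA]; linarith
    nlinarith [sq_nonneg (A - 6 * B)]
  have hn : ‖hh μ t w‖ = ‖P ^ 2 + P‖ * Real.exp (-(P ^ 2 + P).re * t) := by
    unfold hh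
    rw [norm_mul, Complex.norm_exp]
    congr 2
    rw [Complex.re_mul_ofReal, Complex.neg_re]
  have h1 : t * ‖P ^ 2 + P‖ ≤ (64 + T) * Real.exp (t * A ^ 2 / 16 + t * B ^ 2) := by
    have e1 : ‖P ^ 2 + P‖ ≤ ‖P‖ ^ 2 + ‖P‖ := (norm_add_le _ _).trans (by rw [norm_pow])
    have e2 : ‖P‖ ^ 2 ≤ (A + B) ^ 2 := by gcongr
    have e3 : ‖P ^ 2 + P‖ ≤ 4 * A ^ 2 + 4 * B ^ 2 + 1 := by
      nlinarith [sq_nonneg (A - B), sq_nonneg (‖P‖ - 1)]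
    have e4 : t * ‖P ^ 2 + P‖ ≤ t * (4 * A ^ 2 + 4 * B ^ 2 + 1) := by gcongr
    have e5 := Real.add_one_le_exp (t * A ^ 2 / 16 + t * B ^ 2)
    have e6 : (64 + T) * (t * A ^ 2 / 16 + t * B ^ 2 + 1) ≤
      (64 + T) * Real.exp (t * A ^ 2 / 16 + t * B ^ 2) := by gcongr
    have e7 : 0 ≤ t * A ^ 2 := by positivity
    have e8 : 0 ≤ t * B ^ 2 := by positivity
    have e9 : 0 ≤ T * (t * A ^ 2) := by positivity
    have e10 : 0 ≤ T * (t * B ^ 2) := by positivity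
    nlinarith
  have hexp : t * A ^ 2 / 16 + t * B ^ 2 + -(P ^ 2 + P).re * t ≤
      (T + 1) + -t * μ ^ 2 / 4 + 20 * t * w.im ^ 4 + -b * |w.re| := by
    have q := quart (b * |w.re|)
    have q2 : (b * |w.re|) ^ 4 = t * w.re ^ 4 := by
      rw [mul_pow, ← ht]; congr 1; rw [← abs_pow, abs_of_nonneg (by positivity)]
    rw [q2] at q
    have a1 : w.re ^ 4 + μ ^ 2 ≤ A ^ 2 := by
      rw [hA]; nlinarith [mul_nonneg (sq_nonneg w.re) hμ]
    have a2 : t * (w.re ^ 4 + μ ^ 2) ≤ t * A ^ 2 := by gcongr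
    have a3 : t * (A ^ 2 / 2 - 17 * B ^ 2 - B) ≤ t * (P ^ 2 + P).re := by gcongr
    have a4 : t * B ≤ t * (B ^ 2 + 1) := by
      gcongr; nlinarith [sq_nonneg (B - 1)]
    have a5 : w.im ^ 4 = B ^ 2 := by rw [hB]; ring
    rw [a5]
    have a6 : 0 ≤ t * B ^ 2 := by positivity
    have a7 : 0 ≤ t * A ^ 2 := by positivity
    nlinarith
  rw [hn]
  have : t * (‖P ^ 2 + P‖ * Real.exp (-(P ^ 2 + P).re * t)) ≤
     (64 + T) * (Real.exp (T + 1) * Real.exp (-t * μ ^ 2 / 4) * Real.exp (20 * t * w.im ^ 4) * Real.exp (-b * |w.re|)) := by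
    rw [← mul_assoc]
    refine (mul_le_mul_of_nonneg_right h1 (Real.exp_nonneg _)).trans ?_
    rw [mul_assoc, ← Real.exp_add, ← Real.exp_add, ← Real.exp_add, ← Real.exp_add]
    gcongr
  rw [mul_comm, ← le_div_iff₀ ht0] at this
  refine this.trans (le_of_eq ?_)
  ring

lemma one_sub_exp_inv (b : ℝ) (hb : 0 < b) : 1 / (1 - Real.exp (-b)) ≤ Real.exp b / b := by
  have h1 : Real.exp (-b) < 1 := by simpa using hb
  have h2 := Real.add_one_le_exp b
  have h3 : Real.exp b * Real.exp (-b) = 1 := by rw [← Real.exp_add]; simp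
  rw [div_le_div_iff₀ (by linarith) hb]
  nlinarith

lemma nat_geom (b : ℝ) (hb : 0 < b) :
    HasSum (fun n : ℕ => Real.exp (-b * n)) (1 / (1 - Real.exp (-b))) := by
  have h1 : Real.exp (-b) < 1 := by simpa using hb
  have := hasSum_geometric_of_lt_one (Real.exp_nonneg (-b)) h1
  rw [one_div]
  convert this using 2 with n
  rw [← Real.exp_nat_mul]; ring_nf

lemma int_geom (b : ℝ) (hb : 0 < b) : ∃ s, HasSum (fun k : ℤ => Real.exp (-b * |(k : ℝ)|)) s ∧
    s ≤ 2 * Real.exp b / b := by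
  have h := nat_geom b hb
  have h2 := h.mul_left (Real.exp (-b))
  have h1 : Real.exp (-b) < 1 := by simpa using hb
  refine ⟨_, HasSum.of_nat_of_neg_add_one (f := fun k : ℤ => Real.exp (-b * |(k : ℝ)|))
    (m := 1 / (1 - Real.exp (-b))) (m' := Real.exp (-b) * (1 / (1 - Real.exp (-b)))) ?_ ?_, ?_⟩
  · simpa using h
  · have e : (fun n : ℕ => Real.exp (-b * |((-((n : ℤ) + 1) : ℤ) : ℝ)|)) =
        fun n : ℕ => Real.exp (-b) * Real.exp (-b * n) := ?_
    · rw [e]; exact h2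
    ext n
    rw [← Real.exp_add]
    congr 1
    push_cast
    rw [abs_neg, abs_of_nonneg (by positivity)]
    ring
  · have := one_sub_exp_inv b hb
    have h3 : 0 ≤ 1 / (1 - Real.exp (-b)) := by apply one_div_nonneg.2; linarith
    have : Real.exp (-b) * (1 / (1 - Real.exp (-b))) ≤ 1 * (1 / (1 - Real.exp (-b))) := by gcongr
    rw [mul_div_assoc]; linarith

lemma int_geom_shift (b : ℝ) (hb : 0 < b) (ξ : ℝ) :
    ∃ s, HasSum (fun k : ℤ => Real.exp (-b * |(k : ℝ) + ξ|)) s ∧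
    s ≤ 2 * Real.exp (2 * b) / b := by
  obtain ⟨s, hs, hle⟩ := int_geom b hb
  have hs2 := hs.mul_left (Real.exp b)
  have key : ∀ k : ℤ, Real.exp (-b * |(k : ℝ) + Int.fract ξ|) ≤ Real.exp b * Real.exp (-b * |(k : ℝ)|) := by
    intro k
    rw [← Real.exp_add]
    apply Real.exp_le_exp.2
    have h1 : |(k : ℝ)| ≤ |(k : ℝ) + Int.fract ξ| + 1 := by
      have := abs_sub_abs_le_abs_sub (k : ℝ) ((k : ℝ) + Int.fract ξ)
      have h3 : |(k : ℝ) - ((k : ℝ) + Int.fract ξ)| ≤ 1 := by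
        rw [sub_add_cancel_left, abs_neg, abs_of_nonneg (Int.fract_nonneg ξ)]
        exact (Int.fract_lt_one ξ).le
      linarith
    nlinarith
  have hsum : Summable (fun k : ℤ => Real.exp (-b * |(k : ℝ) + Int.fract ξ|)) :=
    Summable.of_nonneg_of_le (fun _ => Real.exp_nonneg _) key hs2.summable
  refine ⟨∑' k : ℤ, Real.exp (-b * |(k : ℝ) + Int.fract ξ|), ?_, ?_⟩
  · have := (Equiv.addRight ⌊ξ⌋).hasSum_iff.2 hsum.hasSum
    convert this using 2 with k
    simp only [Function.comp, Equiv.coe_addRight, Int.cast_add]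
    rw [← Int.floor_add_fract ξ]
    simp [add_assoc]
  · have := hsum.hasSum.unique (hsum.hasSum)
    have h1 := hasSum_le key hsum.hasSum hs2
    refine h1.trans ?_
    calc Real.exp b * s ≤ Real.exp b * (2 * Real.exp b / b) := by gcongr
      _ = _ := by rw [two_mul b, Real.exp_add]; ring

lemma differentiable_hh (μ t : ℝ) : Differentiable ℂ (hh μ t) := by
  unfold hh; fun_prop

def FF (μ t z : ℝ) (a : ℂ) : ℂ := ∑' k : ℤ, hh μ t ((k : ℂ) + a) * Complex.exp (Complex.I * k * z)

lemma norm_eikz (k : ℤ) (z : ℝ) : ‖Complex.exp (Complex.I * k * z)‖ = 1 := by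
  rw [Complex.norm_exp]; simp

def C0 (T : ℝ) : ℝ := ((64 + T) * Real.exp (T + 1))

lemma term_bound (T μ b z : ℝ) (hμ : 0 ≤ μ) (hb : 0 < b) (hbT : b ^ 4 ≤ T) (k : ℤ) (a : ℂ) :
    ‖hh μ (b ^ 4) ((k : ℂ) + a) * Complex.exp (Complex.I * k * z)‖ ≤
      (C0 T / b ^ 4 * Real.exp (-(b ^ 4) * μ ^ 2 / 4) *
      Real.exp (20 * b ^ 4 * a.im ^ 4)) * Real.exp (-b * |(k : ℝ) + a.re|) := by
  rw [norm_mul, norm_eikz, mul_one, C0]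
  simpa using hh_bound T μ b hμ hb hbT ((k : ℂ) + a)

lemma FF_summable (T μ b z : ℝ) (hμ : 0 ≤ μ) (hb : 0 < b) (hbT : b ^ 4 ≤ T) (a : ℂ) :
    Summable fun k : ℤ => hh μ (b ^ 4) ((k : ℂ) + a) * Complex.exp (Complex.I * k * z) := by
  obtain ⟨s, hs, -⟩ := int_geom_shift b hb a.re
  exact Summable.of_norm_bounded (hs.mul_left _).summable
    (fun k => term_bound T μ b z hμ hb hbT k a)

lemma FF_bound (T μ b z : ℝ) (hμ : 0 ≤ μ) (hb : 0 < b) (hbT : b ^ 4 ≤ T) (a : ℂ) :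
    ‖FF μ (b ^ 4) z a‖ ≤ C0 T / b ^ 4 * Real.exp (-(b ^ 4) * μ ^ 2 / 4) *
      Real.exp (20 * b ^ 4 * a.im ^ 4) * (2 * Real.exp (2 * b) / b) := by
  obtain ⟨s, hs, hle⟩ := int_geom_shift b hb a.re
  have hT : 0 < T := lt_of_lt_of_le (by positivity) hbT
  refine (tsum_of_norm_bounded (hs.mul_left _)
    (fun k => term_bound T μ b z hμ hb hbT k a)).trans ?_
  have : 0 ≤ C0 T := by unfold C0; positivity
  gcongr

lemma FF_diff (T μ b z : ℝ) (hμ : 0 ≤ μ) (hb : 0 < b) (hbT : b ^ 4 ≤ T) :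
    Differentiable ℂ (FF μ (b ^ 4) z) := by
  have hT : 0 < T := lt_of_lt_of_le (by positivity) hbT
  have hC : 0 ≤ C0 T := by unfold C0; positivity
  intro a₀
  set N := ‖a₀‖ + 1 with hN
  obtain ⟨s, hs, -⟩ := int_geom b hb
  have := Complex.differentiableOn_tsum_of_summable_norm (U := Metric.ball (0 : ℂ) N)
    (F := fun (k : ℤ) a => hh μ (b ^ 4) ((k : ℂ) + a) * Complex.exp (Complex.I * k * z))
    (hs.mul_left ((C0 T / b ^ 4 * Real.exp (-(b ^ 4) * μ ^ 2 / 4) *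
      Real.exp (20 * b ^ 4 * N ^ 4)) * Real.exp (b * N))).summable ?_ Metric.isOpen_ball ?_
  · have h2 := this.differentiableAt (x := a₀) (Metric.isOpen_ball.mem_nhds (by simp [hN]))
    exact h2
  · intro k
    apply Differentiable.differentiableOn
    exact ((differentiable_hh μ (b ^ 4)).comp (differentiable_id.const_add _)).mul_const _
  · intro k w hw
    have hw' : ‖w‖ < N := by simpa using hw
    refine (term_bound T μ b z hμ hb hbT k w).trans ?_
    have him : w.im ^ 4 ≤ N ^ 4 := by
      have : |w.im| ≤ N := (Complex.abs_im_le_norm w).trans hw'.le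
      rw [← abs_of_nonneg (show 0 ≤ w.im ^ 4 by positivity), abs_pow]
      gcongr
    have hre : |w.re| ≤ N := (Complex.abs_re_le_norm w).trans hw'.le
    rw [mul_assoc _ (Real.exp (b * N)), ← Real.exp_add (b * N)]
    gcongr
    have h3 := abs_sub_abs_le_abs_sub (k : ℝ) ((k : ℝ) + w.re)
    rw [sub_add_cancel_left, abs_neg] at h3
    nlinarith

lemma FF_shift (μ t z : ℝ) (a : ℂ) :
    FF μ t z (a + 1) = Complex.exp (-(Complex.I * z)) * FF μ t z a := by
  unfold FF
  rw [← tsum_mul_left, ← (Equiv.addRight (1:ℤ)).tsum_eq (fun k : ℤ => Complex.exp (-(Complex.I * z)) * _)]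
  congr 1; ext k
  simp only [Equiv.coe_addRight, Int.cast_add, Int.cast_one]
  rw [mul_left_comm, ← Complex.exp_add]
  congr 2
  · ring
  · ring

def kap : ℝ := (2 / π) * Real.exp (-21)

lemma lemD (T μ b z δ : ℝ) (hμ : 0 ≤ μ) (hb : 0 < b) (hbT : b ^ 4 ≤ T) (hδ : 0 ≤ δ)
    (hz : 2 / π * δ ≤ ‖Complex.exp (-(Complex.I * z)) - 1‖) :
    ‖FF μ (b ^ 4) z 0‖ ≤ C0 T / b ^ 4 * Real.exp (-(b ^ 4) * μ ^ 2 / 4) *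
      (2 * Real.exp (2 * b) / b) * Real.exp 21 * Real.exp (-((kap * (δ / b)) ^ ((4:ℝ) / 3))) := by
  have hT : 0 < T := lt_of_lt_of_le (by positivity) hbT
  have hC : 0 ≤ C0 T := by unfold C0; positivity
  set M := C0 T / b ^ 4 * Real.exp (-(b ^ 4) * μ ^ 2 / 4) * (2 * Real.exp (2 * b) / b) with hM
  have hM0 : 0 ≤ M := by positivity
  rcases hδ.eq_or_lt with h0 | h0
  · subst h0
    have := FF_bound T μ b z hμ hb hbT 0
    have this : ‖FF μ (b ^ 4) z 0‖ ≤ M := by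
      refine this.trans (le_of_eq ?_)
      rw [hM]; simp
    rw [zero_div, mul_zero, Real.zero_rpow (by norm_num)]
    have h1 : M ≤ M * Real.exp 21 := le_mul_of_one_le_right hM0 (Real.one_le_exp (by norm_num))
    simpa using this.trans h1
  have hk : 0 < kap := by unfold kap; positivity
  set X := kap * (δ / b) with hX
  have hX0 : 0 < X := by positivity
  set ρ := X ^ ((1:ℝ)/3) with hρ
  have hρ0 : 0 < ρ := by positivity
  have hρ3 : ρ ^ 3 = X := by
    rw [hρ, ← Real.rpow_natCast, ← Real.rpow_mul hX0.le]; norm_num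
  have hρ4 : X ^ ((4:ℝ)/3) = ρ ^ 4 := by
    rw [hρ, ← Real.rpow_natCast, ← Real.rpow_mul hX0.le]; norm_num
  rw [hρ4]
  set m := ⌊ρ ^ 4⌋₊ with hm
  have hm1 : (m : ℝ) ≤ ρ ^ 4 := Nat.floor_le (by positivity)
  have hm2 : ρ ^ 4 < m + 1 := Nat.lt_floor_add_one _
  have hA := lemA (FF μ (b ^ 4) z) (FF_diff T μ b z hμ hb hbT) _ (2 / π * δ) (by positivity) hz
    (FF_shift μ (b ^ 4) z) (ρ / b) (M * Real.exp (20 * ρ ^ 4)) (by positivity) (by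
      intro a ha
      refine (FF_bound T μ b z hμ hb hbT a).trans ?_
      have h1 : b ^ 4 * a.im ^ 4 ≤ ρ ^ 4 := by
        rw [← mul_pow]
        have : |b * a.im| ≤ ρ := by
          rw [abs_mul, abs_of_pos hb]; rw [le_div_iff₀ hb] at ha; linarith
        rw [← abs_of_nonneg (show 0 ≤ (b * a.im) ^ 4 by positivity), abs_pow]
        gcongr
      calc _ = M * Real.exp (20 * b ^ 4 * a.im ^ 4) := by rw [hM]; ring
        _ ≤ _ := by
          apply mul_le_mul_of_nonneg_left _ hM0
          apply Real.exp_le_exp.2; linarith) m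
  have hfac : (m.factorial : ℝ) ≤ (ρ ^ 4) ^ m := by
    calc (m.factorial : ℝ) ≤ (m : ℝ) ^ m := by exact_mod_cast Nat.factorial_le_pow m
      _ ≤ _ := by gcongr
  -- q * r = (2/π) δ ρ / b ; X = kap δ / b, so q r = X ρ e^21 = ρ^4 e^21
  have hqr : (2 / π * δ) * (ρ / b) = ρ ^ 4 * Real.exp 21 := by
    have : ρ ^ 4 = X * ρ := by rw [← hρ3]; ring
    rw [this, hX, kap, Real.exp_neg]
    field_simp
  have hA2 : (ρ ^ 4) ^ m * (Real.exp 21 ^ m * ‖FF μ (b ^ 4) z 0‖) ≤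
      (ρ ^ 4) ^ m * (M * Real.exp (20 * ρ ^ 4)) := by
    rw [le_div_iff₀ (by positivity)] at hA
    calc _ = ((2 / π * δ) * (ρ / b)) ^ m * ‖FF μ (b ^ 4) z 0‖ := by rw [hqr, mul_pow]; ring
      _ = (2 / π * δ) ^ m * ‖FF μ (b ^ 4) z 0‖ * (ρ / b) ^ m := by rw [mul_pow]; ring
      _ ≤ _ := hA
      _ ≤ _ := by gcongr
  have hA3 := le_of_mul_le_mul_left hA2 (by positivity)
  have he : Real.exp 21 ^ m = Real.exp (21 * m) := by rw [← Real.exp_nat_mul]; ring_nf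
  rw [he] at hA3
  have hA4 : ‖FF μ (b ^ 4) z 0‖ ≤ M * (Real.exp (20 * ρ ^ 4) * Real.exp (-(21 * m))) := by
    rw [Real.exp_neg, ← mul_assoc, ← div_eq_mul_inv, le_div_iff₀ (Real.exp_pos _)]; linarith
  refine hA4.trans ?_
  rw [mul_assoc M, ← Real.exp_add, ← Real.exp_add]
  apply mul_le_mul_of_nonneg_left _ hM0
  apply Real.exp_le_exp.2; linarith

lemma phase_bound (x y : ℝ) (hx : x ∈ Ioo (0:ℝ) π) (hy : y ∈ Ioo (0:ℝ) π) :
    2 / π * |x - y| ≤ ‖Complex.exp (-(Complex.I * ((x - y : ℝ) : ℂ))) - 1‖ ∧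
    2 / π * |x - y| ≤ ‖Complex.exp (-(Complex.I * ((x + y : ℝ) : ℂ))) - 1‖ := by
  obtain ⟨hx0, hx1⟩ := hx
  obtain ⟨hy0, hy1⟩ := hy
  have gen : ∀ z : ℝ, ‖Complex.exp (-(Complex.I * (z : ℂ))) - 1‖ = 2 * |Real.sin (z / 2)| := by
    intro z
    have := Complex.norm_exp_I_mul_ofReal_sub_one (-z)
    rw [Complex.ofReal_neg, mul_neg] at this
    rw [this, neg_div, Real.sin_neg]; simp
  have h1 : 2 / π * |x - y| ≤ 2 * |Real.sin ((x - y) / 2)| := by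
    have := Real.mul_abs_le_abs_sin (x := (x - y) / 2) (by
      rw [abs_div, abs_two]
      have : |x - y| ≤ π := by rw [abs_le]; constructor <;> linarith
      linarith)
    rw [abs_div, abs_two] at this
    linarith
  rw [gen, gen]
  refine ⟨h1, h1.trans ?_⟩
  have h2 : |Real.sin ((x - y) / 2)| ≤ |Real.sin ((x + y) / 2)| := by
    rw [← sq_le_sq]
    have e : Real.sin ((x + y) / 2) ^ 2 - Real.sin ((x - y) / 2) ^ 2 = Real.sin x * Real.sin y := by
      have a1 : Real.sin x = Real.sin ((x + y) / 2 + (x - y) / 2) := by congr 1; ring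
      have a2 : Real.sin y = Real.sin ((x + y) / 2 - (x - y) / 2) := by congr 1; ring
      rw [a1, a2, Real.sin_add, Real.sin_sub]
      have c1 := Real.sin_sq_add_cos_sq ((x + y) / 2)
      have c2 := Real.sin_sq_add_cos_sq ((x - y) / 2)
      linear_combination (-Real.sin ((x + y) / 2) ^ 2) * c2 + (Real.sin ((x - y) / 2) ^ 2) * c1
    have := mul_pos (Real.sin_pos_of_pos_of_lt_pi hx0 hx1) (Real.sin_pos_of_pos_of_lt_pi hy0 hy1)
    linarith
  linarith

def gg (μ t : ℝ) : ℝ := (μ ^ 2 + μ) * Real.exp (-(μ ^ 2 + μ) * t)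

lemma hh_ofReal (μ t : ℝ) (r : ℝ) : hh μ t (r : ℂ) = ((gg (r ^ 2 + μ) t : ℝ) : ℂ) := by
  unfold hh gg; push_cast; rfl

lemma gg_nonneg (μ t : ℝ) (hμ : 0 ≤ μ) : 0 ≤ gg μ t := by unfold gg; positivity

lemma eps_prod (j : ℕ) (x y : ℝ) : (2 * π) * (eps1 j x * eps1 j y) =
    2 * (Real.cos (j * (x - y)) + Real.cos (j * (x + y))) - if j = 0 then 2 else 0 := by
  have hπ := Real.pi_pos
  unfold eps1
  split_ifs with h
  · subst h
    have := Real.mul_self_sqrt hπ.le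
    simp
    field_simp
    nlinarith
  · have := Real.mul_self_sqrt (show 0 ≤ 2 / π by positivity)
    rw [mul_sub (j : ℝ) x y, mul_add (j : ℝ) x y, Real.cos_add, Real.cos_sub]
    calc _ = (2 * π) * (√(2 / π) * √(2 / π)) * (Real.cos (j * x) * Real.cos (j * y)) := by ring
      _ = _ := by rw [this]; field_simp; ring

lemma lemE (T μ b δ x y : ℝ) (hx : x ∈ Ioo (0:ℝ) π) (hy : y ∈ Ioo (0:ℝ) π)
    (hμ : 0 ≤ μ) (hb : 0 < b) (hbT : b ^ 4 ≤ T) (hδ : 0 ≤ δ) (hδ2 : δ ≤ |x - y|) :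
    |∑' j : ℕ, gg ((j : ℝ) ^ 2 + μ) (b ^ 4) * (eps1 j x * eps1 j y)| ≤
      C0 T / b ^ 4 * Real.exp (-(b ^ 4) * μ ^ 2 / 4) *
      (2 * Real.exp (2 * b) / b) * Real.exp 21 * Real.exp (-((kap * (δ / b)) ^ ((4:ℝ) / 3))) := by
  have hπ := Real.pi_pos
  obtain ⟨p1, p2⟩ := phase_bound x y hx hy
  have q : 2 / π * δ ≤ 2 / π * |x - y| := by gcongr
  have d1 := lemD T μ b (x - y) δ hμ hb hbT hδ (q.trans p1)
  have d2 := lemD T μ b (x + y) δ hμ hb hbT hδ (q.trans p2)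
  set K := C0 T / b ^ 4 * Real.exp (-(b ^ 4) * μ ^ 2 / 4) *
      (2 * Real.exp (2 * b) / b) * Real.exp 21 * Real.exp (-((kap * (δ / b)) ^ ((4:ℝ) / 3)))
  have s1 := (FF_summable T μ b (x - y) hμ hb hbT 0).hasSum
  have s2 := (FF_summable T μ b (x + y) hμ hb hbT 0).hasSum
  change HasSum _ (FF μ (b ^ 4) (x - y) 0) at s1
  change HasSum _ (FF μ (b ^ 4) (x + y) 0) at s2
  have s3 := (s1.add s2).nat_add_neg
  have s4 := s3.sub (hasSum_ite_eq (0 : ℕ)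
    (hh μ (b ^ 4) (((0 : ℤ) : ℂ) + 0) * Complex.exp (Complex.I * ((0 : ℤ) : ℂ) * ((x - y : ℝ) : ℂ))
    + hh μ (b ^ 4) (((0 : ℤ) : ℂ) + 0) * Complex.exp (Complex.I * ((0 : ℤ) : ℂ) * ((x + y : ℝ) : ℂ))))
  rw [add_sub_cancel_right] at s4
  have s5 : HasSum (fun j : ℕ => ((2 * π * (gg ((j : ℝ) ^ 2 + μ) (b ^ 4) * (eps1 j x * eps1 j y)) : ℝ) : ℂ))
      (FF μ (b ^ 4) (x - y) 0 + FF μ (b ^ 4) (x + y) 0) := by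
    refine Eq.mp (congrArg (fun f : ℕ → ℂ => HasSum f
      (FF μ (b ^ 4) (x - y) 0 + FF μ (b ^ 4) (x + y) 0)) (funext fun j => ?_)) s4
    symm
    have ec : ∀ z : ℝ, Complex.exp (Complex.I * (j : ℂ) * (z : ℂ)) +
        Complex.exp (Complex.I * (-(j : ℂ)) * (z : ℂ)) = ((2 * Real.cos (j * z) : ℝ) : ℂ) := by
      intro z
      push_cast
      rw [Complex.cos]
      ring_nf
    have hneg : hh μ (b ^ 4) (-(j : ℂ)) = hh μ (b ^ 4) (j : ℂ) := by unfold hh; ring_nf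
    have hj := hh_ofReal μ (b ^ 4) (j : ℝ)
    rw [Complex.ofReal_natCast] at hj
    have e0 := eps_prod j x y
    have lhs : 2 * π * (gg ((j : ℝ) ^ 2 + μ) (b ^ 4) * (eps1 j x * eps1 j y)) =
      gg ((j : ℝ) ^ 2 + μ) (b ^ 4) * (2 * (Real.cos (j * (x - y)) + Real.cos (j * (x + y)))
        - if j = 0 then 2 else 0) := by rw [← e0]; ring
    rw [lhs]
    have c1 := ec (x - y)
    have c2 := ec (x + y)
    simp only [Int.cast_neg, Int.cast_natCast, add_zero, Int.cast_zero, mul_zero, zero_mul,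
      Complex.exp_zero, mul_one]
    rw [hneg]
    have hite : (if j = 0 then hh μ (b ^ 4) 0 + hh μ (b ^ 4) 0 else 0) =
        hh μ (b ^ 4) (j : ℂ) * (((if j = 0 then 2 else 0 : ℝ)) : ℂ) := by
      split_ifs with h
      · subst h; push_cast; ring
      · simp
    rw [hite]
    have c3 : hh μ (b ^ 4) (j : ℂ) * Complex.exp (Complex.I * (j : ℂ) * ((x - y : ℝ) : ℂ)) +
        hh μ (b ^ 4) (j : ℂ) * Complex.exp (Complex.I * (j : ℂ) * ((x + y : ℝ) : ℂ)) +
        (hh μ (b ^ 4) (j : ℂ) * Complex.exp (Complex.I * (-(j : ℂ)) * ((x - y : ℝ) : ℂ)) +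
        hh μ (b ^ 4) (j : ℂ) * Complex.exp (Complex.I * (-(j : ℂ)) * ((x + y : ℝ) : ℂ))) =
        hh μ (b ^ 4) (j : ℂ) * (((2 * Real.cos (j * (x - y)) : ℝ) : ℂ) +
          ((2 * Real.cos (j * (x + y)) : ℝ) : ℂ)) := by
      rw [← c1, ← c2]; ring
    rw [c3, hj, Complex.ofReal_mul, Complex.ofReal_sub, mul_sub, mul_add 2, Complex.ofReal_add]
  have s6 := Complex.hasSum_re s5
  simp only [Complex.ofReal_re] at s6
  have s7 := s6.tsum_eq
  rw [tsum_mul_left] at s7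
  set S := ∑' j : ℕ, gg ((j : ℝ) ^ 2 + μ) (b ^ 4) * (eps1 j x * eps1 j y)
  have s8 : 2 * π * |S| ≤ 2 * K := by
    rw [← abs_of_pos (show 0 < 2 * π by positivity), ← abs_mul, s7]
    calc _ ≤ ‖FF μ (b ^ 4) (x - y) 0 + FF μ (b ^ 4) (x + y) 0‖ := Complex.abs_re_le_norm _
      _ ≤ _ := norm_add_le _ _
      _ ≤ _ := by linarith
  have := Real.pi_gt_three
  nlinarith [abs_nonneg S]

lemma hasSum_pi_prod (f : ℕ → ℝ) (hf : ∀ n, 0 ≤ f n) (s : ℝ) (hs : HasSum f s) (m : ℕ) :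
    HasSum (fun k : Fin m → ℕ => ∏ i, f (k i)) (s ^ m) := by
  induction m with
  | zero =>
    simp only [Finset.univ_eq_empty, Finset.prod_empty, pow_zero]
    simp
  | succ m ih =>
    have hp : (0 : (Fin m → ℕ) → ℝ) ≤ fun k => ∏ i, f (k i) := by
      intro k
      exact Finset.prod_nonneg fun i _ => hf _
    have hf0 : (0 : ℕ → ℝ) ≤ f := fun n => hf n
    have hsm : Summable (fun x : ℕ × (Fin m → ℕ) => f x.1 * ∏ i, f (x.2 i)) :=
      Summable.mul_of_nonneg (g := fun k : Fin m → ℕ => ∏ i, f (k i)) hs.summable ih.summable hf0 hp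
    have h1 : HasSum (fun x : ℕ × (Fin m → ℕ) => f x.1 * ∏ i, f (x.2 i)) (s * s ^ m) :=
      HasSum.mul (g := fun k : Fin m → ℕ => ∏ i, f (k i)) hs ih hsm
    rw [← (Fin.consEquiv (fun _ : Fin (m+1) => ℕ)).hasSum_iff, pow_succ']
    have e : ((fun k : Fin (m+1) → ℕ => ∏ i, f (k i)) ∘ (Fin.consEquiv (fun _ : Fin (m+1) => ℕ)))
      = fun x : ℕ × (Fin m → ℕ) => f x.1 * ∏ i, f (x.2 i) := by
      ext x
      simp [Fin.consEquiv, Fin.prod_univ_succ]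
    rw [e]; exact h1

lemma lam_nonneg {d : ℕ} (k : Fin d → ℕ) : 0 ≤ lam k := by unfold lam; positivity

lemma weight_bound {d : ℕ} (b : ℝ) (hb : 0 < b) (k : Fin d → ℕ) :
    Real.exp (-(b ^ 4) * lam k ^ 2 / 4) ≤ ∏ i, (Real.exp 1 * Real.exp (-b * (k i : ℝ))) := by
  have h1 : ∑ i, ((k i : ℝ) ^ 2) ^ 2 ≤ lam k ^ 2 :=
    Finset.sum_sq_le_sq_sum_of_nonneg (fun i _ => by positivity)
  have h2 : ∑ i, (b * (k i : ℝ) - 1) ≤ ∑ i, (b ^ 4 / 4) * ((k i : ℝ) ^ 2) ^ 2 := by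
    apply Finset.sum_le_sum
    intro i _
    have := quart (b * (k i : ℝ))
    calc _ ≤ _ := this
      _ = _ := by ring
  rw [← Finset.mul_sum] at h2
  have h3 : (b ^ 4 / 4) * ∑ i, ((k i : ℝ) ^ 2) ^ 2 ≤ (b ^ 4 / 4) * lam k ^ 2 := by gcongr
  simp_rw [← Real.exp_add]
  rw [← Real.exp_sum]
  apply Real.exp_le_exp.2
  have h4 : ∑ i, (1 + -b * (k i : ℝ)) = - ∑ i, (b * (k i : ℝ) - 1) := by
    rw [← Finset.sum_neg_distrib]; congr 1; ext i; ring
  rw [h4]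
  linarith

lemma weight_hasSum (d : ℕ) (b : ℝ) (hb : 0 < b) :
    HasSum (fun k : Fin d → ℕ => ∏ i, (Real.exp 1 * Real.exp (-b * (k i : ℝ))))
      ((Real.exp 1 * (1 / (1 - Real.exp (-b)))) ^ d) :=
  hasSum_pi_prod (fun n => Real.exp 1 * Real.exp (-b * (n : ℝ))) (fun n => by positivity) _
    ((nat_geom b hb).mul_left _) d

lemma eps1_le (j : ℕ) (x : ℝ) : |eps1 j x| ≤ 1 := by
  have hπ := Real.pi_gt_three
  unfold eps1
  split_ifs
  · rw [abs_of_nonneg (by positivity), div_le_one (by positivity), Real.one_le_sqrt]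
    linarith
  · rw [abs_mul, abs_of_nonneg (Real.sqrt_nonneg _)]
    have h1 : √(2 / π) ≤ 1 := by
      rw [Real.sqrt_le_one, div_le_one (by positivity)]; linarith
    exact mul_le_one₀ h1 (abs_nonneg _) (Real.abs_cos_le_one _)

lemma epsk_le {d : ℕ} (k : Fin d → ℕ) (x : EuclideanSpace ℝ (Fin d)) : |epsk k x| ≤ 1 := by
  unfold epsk
  rw [Finset.abs_prod]
  exact Finset.prod_le_one (fun _ _ => abs_nonneg _) (fun _ _ => eps1_le _ _)

lemma gg_bound (μ b : ℝ) (hμ : 0 ≤ μ) (hb : 0 < b) :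
    gg μ (b ^ 4) ≤ C0 (b ^ 4) / b ^ 4 * Real.exp (-(b ^ 4) * μ ^ 2 / 4) := by
  have := hh_bound (b ^ 4) μ b hμ hb le_rfl 0
  have e := hh_ofReal μ (b ^ 4) 0
  rw [Complex.ofReal_zero] at e
  rw [e, Complex.norm_real, Real.norm_eq_abs] at this
  simp only [ne_eq, OfNat.ofNat_ne_zero, not_false_eq_true, zero_pow, zero_add, Complex.zero_im,
    mul_zero, Real.exp_zero, mul_one, Complex.zero_re, abs_zero] at this
  exact (le_abs_self _).trans this

lemma deriv_summable {d : ℕ} (b : ℝ) (hb : 0 < b) :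
    Summable fun k : Fin d → ℕ => gg (lam k) (b ^ 4) := by
  refine Summable.of_nonneg_of_le (fun k => gg_nonneg _ _ (lam_nonneg k)) (fun k => ?_)
    ((weight_hasSum d b hb).mul_left (C0 (b ^ 4) / b ^ 4)).summable
  refine (gg_bound _ b (lam_nonneg k) hb).trans ?_
  have : 0 ≤ C0 (b ^ 4) := by unfold C0; positivity
  gcongr
  exact weight_bound b hb k

lemma green_summable {d : ℕ} (x y : EuclideanSpace ℝ (Fin d)) (b : ℝ) (hb : 0 < b) :
    Summable fun k : Fin d → ℕ => Real.exp (-(lam k ^ 2 + lam k) * b ^ 4) * epsk k x * epsk k y := by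
  refine Summable.of_norm_bounded (weight_hasSum d b hb).summable (fun k => ?_)
  refine le_trans ?_ (weight_bound b hb k)
  rw [norm_mul, norm_mul, Real.norm_eq_abs, Real.norm_eq_abs, Real.norm_eq_abs, Real.abs_exp]
  have h1 := epsk_le k x
  have h2 := epsk_le k y
  have h3 : Real.exp (-(lam k ^ 2 + lam k) * b ^ 4) ≤ Real.exp (-(b ^ 4) * lam k ^ 2 / 4) := by
    apply Real.exp_le_exp.2
    have := lam_nonneg k
    have a1 : 0 ≤ b ^ 4 * lam k := by positivity
    have a2 : 0 ≤ b ^ 4 * lam k ^ 2 := by positivity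
    nlinarith
  calc _ ≤ Real.exp (-(b ^ 4) * lam k ^ 2 / 4) * 1 * 1 := by gcongr
    _ = _ := by ring

lemma green_hasDeriv {d : ℕ} (x y : EuclideanSpace ℝ (Fin d)) (t : ℝ) (ht : 0 < t) :
    HasDerivAt (fun s => green x y s) (∑' k : Fin d → ℕ, -(gg (lam k) t * (epsk k x * epsk k y))) t := by
  have pw : ∀ s : ℝ, 0 < s → ∃ b : ℝ, 0 < b ∧ b ^ 4 = s := fun s hs =>
    ⟨s ^ ((1:ℝ)/4), by positivity, by rw [← Real.rpow_natCast, ← Real.rpow_mul hs.le]; norm_num⟩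
  obtain ⟨b, hb, hbt⟩ := pw (t / 2) (by positivity)
  obtain ⟨b', hb', hbt'⟩ := pw t ht
  refine hasDerivAt_tsum_of_isPreconnected (t := Ioi (t / 2)) (y₀ := t)
    (g := fun (k : Fin d → ℕ) s => Real.exp (-(lam k ^ 2 + lam k) * s) * epsk k x * epsk k y)
    (g' := fun (k : Fin d → ℕ) s => -(gg (lam k) s * (epsk k x * epsk k y)))
    (deriv_summable (d := d) b hb) isOpen_Ioi isPreconnected_Ioi ?_ ?_ ?_ ?_ ?_
  · intro k s _
    have h1 : HasDerivAt (fun s : ℝ => -(lam k ^ 2 + lam k) * s) (-(lam k ^ 2 + lam k)) s := by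
      have := (hasDerivAt_id s).const_mul (-(lam k ^ 2 + lam k))
      rw [mul_one] at this
      exact this
    refine ((h1.exp.mul_const (epsk k x)).mul_const (epsk k y)).congr_deriv ?_
    unfold gg; ring
  · intro k s hs
    have hs : t / 2 < s := hs
    rw [norm_neg, norm_mul, norm_mul, Real.norm_eq_abs, Real.norm_eq_abs, Real.norm_eq_abs]
    have h1 := epsk_le k x
    have h2 := epsk_le k y
    have hl := lam_nonneg k
    rw [abs_of_nonneg (gg_nonneg _ _ hl)]
    have h3 : gg (lam k) s ≤ gg (lam k) (b ^ 4) := by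
      unfold gg
      gcongr ?_ * ?_
      apply Real.exp_le_exp.2
      rw [hbt]
      have : 0 ≤ lam k ^ 2 + lam k := by positivity
      nlinarith
    have := gg_nonneg (lam k) (b ^ 4) hl
    calc _ ≤ gg (lam k) (b ^ 4) * (1 * 1) := by gcongr
      _ = _ := by ring
  · simp [ht]
  · rw [← hbt']; exact green_summable x y b' hb'
  · simp [ht]

lemma main_bound (n : ℕ) (T b δ : ℝ) (hb : 0 < b) (hbT : b ^ 4 ≤ T) (hδ : 0 ≤ δ)
    (x y : EuclideanSpace ℝ (Fin (n+1))) (hx : x ∈ domD (n+1)) (hy : y ∈ domD (n+1))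
    (i : Fin (n+1)) (hi : δ ≤ |x i - y i|) :
    |∑' k : Fin (n+1) → ℕ, -(gg (lam k) (b ^ 4) * (epsk k x * epsk k y))| ≤
      (C0 T / b ^ 4 * (2 * Real.exp (2 * b) / b) * Real.exp 21 *
        Real.exp (-((kap * (δ / b)) ^ ((4:ℝ) / 3)))) * (Real.exp 1 * (Real.exp b / b)) ^ n := by
  have hT : 0 < T := lt_of_lt_of_le (by positivity) hbT
  have hC : 0 ≤ C0 T := by unfold C0; positivity
  rw [tsum_neg, abs_neg]
  have hsum : Summable fun k : Fin (n+1) → ℕ => gg (lam k) (b ^ 4) * (epsk k x * epsk k y) := by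
    refine Summable.of_norm_bounded (deriv_summable b hb) (fun k => ?_)
    have hl := gg_nonneg (lam k) (b ^ 4) (lam_nonneg k)
    rw [norm_mul, norm_mul, Real.norm_eq_abs, Real.norm_eq_abs, Real.norm_eq_abs, abs_of_nonneg hl]
    have h1 := epsk_le k x
    have h2 := epsk_le k y
    calc _ ≤ gg (lam k) (b ^ 4) * (1 * 1) := by gcongr
      _ = _ := by ring
  let e : (Fin n → ℕ) × ℕ ≃ (Fin (n+1) → ℕ) :=
    (Equiv.prodComm _ _).trans (Fin.insertNthEquiv (fun _ => ℕ) i)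
  have hsum2 : Summable fun c : (Fin n → ℕ) × ℕ =>
      gg (lam (e c)) (b ^ 4) * (epsk (e c) x * epsk (e c) y) := e.summable_iff.2 hsum
  rw [← e.tsum_eq, hsum2.tsum_prod, ← Real.norm_eq_abs]
  set K := C0 T / b ^ 4 * (2 * Real.exp (2 * b) / b) * Real.exp 21 *
        Real.exp (-((kap * (δ / b)) ^ ((4:ℝ) / 3))) with hK
  have hK0 : 0 ≤ K := by positivity
  refine (tsum_of_norm_bounded ((weight_hasSum n b hb).mul_left K) (fun k' => ?_)).trans ?_
  · have hterm : ∀ j : ℕ, gg (lam (e (k', j))) (b ^ 4) * (epsk (e (k', j)) x * epsk (e (k', j)) y)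
        = ((∏ l, eps1 (k' l) (x (i.succAbove l))) * (∏ l, eps1 (k' l) (y (i.succAbove l)))) *
          (gg ((j : ℝ) ^ 2 + lam k') (b ^ 4) * (eps1 j (x i) * eps1 j (y i))) := by
      intro j
      have e1 : e (k', j) = i.insertNth j k' := rfl
      have e2 : lam (e (k', j)) = (j : ℝ) ^ 2 + lam k' := by
        rw [e1, lam, Fin.sum_univ_succAbove _ i]; simp [lam]
      have e3 : ∀ v : EuclideanSpace ℝ (Fin (n+1)), epsk (e (k', j)) v =
          eps1 j (v i) * ∏ l, eps1 (k' l) (v (i.succAbove l)) := by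
        intro v
        rw [e1, epsk, Fin.prod_univ_succAbove _ i]; simp
      rw [e2, e3, e3]; ring
    simp_rw [hterm]
    rw [tsum_mul_left, norm_mul, norm_mul, Real.norm_eq_abs, Real.norm_eq_abs, Real.norm_eq_abs]
    have p : ∀ v : EuclideanSpace ℝ (Fin (n+1)), |∏ l, eps1 (k' l) (v (i.succAbove l))| ≤ 1 := by
      intro v
      rw [Finset.abs_prod]
      exact Finset.prod_le_one (fun _ _ => abs_nonneg _) (fun _ _ => eps1_le _ _)
    have E := lemE T (lam k') b δ (x i) (y i) (hx i) (hy i) (lam_nonneg k') hb hbT hδ hi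
    have W := weight_bound b hb k'
    calc _ ≤ 1 * 1 * (C0 T / b ^ 4 * Real.exp (-(b ^ 4) * lam k' ^ 2 / 4) *
      (2 * Real.exp (2 * b) / b) * Real.exp 21 * Real.exp (-((kap * (δ / b)) ^ ((4:ℝ) / 3)))) := by
          gcongr
          · exact p x
          · exact p y
      _ = K * Real.exp (-(b ^ 4) * lam k' ^ 2 / 4) := by rw [hK]; ring
      _ ≤ _ := by gcongr
  · have h1 : Real.exp (-b) < 1 := by simpa using hb
    have h3 : 0 ≤ 1 / (1 - Real.exp (-b)) := by apply one_div_nonneg.2; linarith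
    have := one_sub_exp_inv b hb
    gcongr

/-- Gaussian-type upper bound for the time derivative of the Green's function:
for every `T > 0` there are `c₁, c₂ > 0` such that for `t ∈ (0,T]` and `x, y ∈ D`,
`∂_t G(x,y,t)` exists and `|∂_t G(x,y,t)| ≤ c₁ t^{−(d+4)/4} exp(−c₂ |x−y|^{4/3} t^{−1/3})`. -/
theorem statement5 (d : ℕ) (hd : d = 1 ∨ d = 2 ∨ d = 3) (T : ℝ) (hT : 0 < T) :
    ∃ c₁ > (0 : ℝ), ∃ c₂ > (0 : ℝ), ∀ t ∈ Set.Ioc (0 : ℝ) T,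
      ∀ x ∈ domD d, ∀ y ∈ domD d,
        DifferentiableAt ℝ (fun s => green x y s) t ∧
        |deriv (fun s => green x y s) t| ≤
          c₁ * t ^ (-((d : ℝ) + 4) / 4) *
            Real.exp (-c₂ * ‖x - y‖ ^ ((4 : ℝ) / 3) * t ^ (-(1 : ℝ) / 3)) := by
  obtain ⟨n, rfl⟩ : ∃ n, d = n + 1 := ⟨d - 1, by omega⟩
  have hk : 0 < kap := by unfold kap; positivity
  have hC : 0 < C0 T := by unfold C0; positivity
  set B := T ^ ((1:ℝ)/4) with hB
  refine ⟨C0 T * (2 * Real.exp (2 * B)) * Real.exp 21 * (Real.exp 1 * Real.exp B) ^ n, by positivity,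
    (kap / (n + 1)) ^ ((4:ℝ)/3), by positivity, ?_⟩
  rintro t ⟨ht0, htT⟩ x hx y hy
  have hder := green_hasDeriv x y t ht0
  refine ⟨hder.differentiableAt, ?_⟩
  rw [hder.deriv]
  set b := t ^ ((1:ℝ)/4) with hb
  have hb0 : 0 < b := by positivity
  have hbt : b ^ 4 = t := by rw [hb, ← Real.rpow_natCast, ← Real.rpow_mul ht0.le]; norm_num
  have hbB : b ≤ B := by rw [hb, hB]; gcongr
  obtain ⟨i, -, hi⟩ := Finset.exists_max_image (Finset.univ : Finset (Fin (n+1)))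
    (fun i => |x i - y i|) Finset.univ_nonempty
  set δ := ‖x - y‖ / (n + 1) with hδ
  have hδi : δ ≤ |x i - y i| := by
    rw [hδ, div_le_iff₀ (by positivity), EuclideanSpace.norm_eq]
    apply Real.sqrt_le_iff.2
    refine ⟨by positivity, ?_⟩
    calc ∑ j, ‖(x - y).ofLp j‖ ^ 2 ≤ ∑ j : Fin (n+1), |x i - y i| ^ 2 := by
          apply Finset.sum_le_sum
          intro j hj
          have := hi j hj
          simp only [PiLp.sub_apply, Real.norm_eq_abs]
          gcongr
      _ = |x i - y i| ^ 2 * (n + 1) := by simp; ring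
      _ ≤ |x i - y i| ^ 2 * (n + 1) * (n + 1) := by
          apply le_mul_of_one_le_right (by positivity)
          have : (0:ℝ) ≤ n := by positivity
          linarith
      _ = _ := by ring
  have hmain := main_bound n T b δ hb0 (hbt ▸ htT) (by positivity) x y hx hy i hδi
  rw [hbt] at hmain
  refine hmain.trans ?_
  have hexp : (kap * (δ / b)) ^ ((4:ℝ) / 3) =
      (kap / (n + 1)) ^ ((4:ℝ)/3) * ‖x - y‖ ^ ((4 : ℝ) / 3) * t ^ (-(1 : ℝ) / 3) := by
    have e1 : kap * (δ / b) = (kap / (n + 1)) * ‖x - y‖ * t ^ (-(1:ℝ)/4) := by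
      rw [hδ, hb, neg_div, Real.rpow_neg ht0.le]; field_simp
    rw [e1, Real.mul_rpow (by positivity) (by positivity),
      Real.mul_rpow (by positivity) (by positivity), ← Real.rpow_mul ht0.le]
    norm_num
  have hpow : t ^ (-(((n + 1 : ℕ) : ℝ) + 4) / 4) = 1 / (t * b * b ^ n) := by
    have : t * b * b ^ n = b ^ (n + 5) := by rw [← hbt]; ring
    rw [this, hb, ← Real.rpow_natCast, ← Real.rpow_mul ht0.le, one_div, ← Real.rpow_neg ht0.le]
    congr 1; push_cast; ring
  rw [hexp, hpow, neg_mul, neg_mul]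
  set Ex := Real.exp (-((kap / (n + 1)) ^ ((4:ℝ)/3) * ‖x - y‖ ^ ((4 : ℝ) / 3) * t ^ (-(1 : ℝ) / 3)))
  calc _ = C0 T * (2 * Real.exp (2 * b)) * Real.exp 21 * (Real.exp 1 * Real.exp b) ^ n *
        (1 / (t * b * b ^ n)) * Ex := by
        rw [mul_pow, mul_pow, div_pow]; field_simp
    _ ≤ _ := by gcongr
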